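/- There exist hsops of I_5 (the ring of invariants of the binary quintic) with degree sequence (4, 8, 12) and with degree sequence (4, 8, 18). -/

import Mathlib

set_option synthInstance.maxHeartbeats 1000000
noncomputable section

open MvPolynomial

/-- The binary form of degree `n` with coefficient vector `a`, as a polynomial in two
variables `X 0 = x`, `X 1 = y`. -/
def formPoly (n : ℕ) (a : Fin (n+1) → ℂ) : MvPolynomial (Fin 2) ℂ :=
  ∑ i : Fin (n+1), C (a i) * X 0 ^ (n - (i : ℕ)) * X 1 ^ (i : ℕ)

/-- The action of `SL(2,ℂ)` on coefficient vectors of binary forms of degree `n`,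
given by linear substitution of the variables `x`, `y`. -/
def sl2Act (n : ℕ) (g : Matrix.SpecialLinearGroup (Fin 2) ℂ) (a : Fin (n+1) → ℂ) :
    Fin (n+1) → ℂ := fun i =>
  coeff (Finsupp.single 0 (n - (i : ℕ)) + Finsupp.single 1 (i : ℕ))
    (bind₁ (fun j : Fin 2 => C (g.1 j 0) * X 0 + C (g.1 j 1) * X 1) (formPoly n a))

/-- The ring of invariants `I_n` of the binary form of degree `n`: the subalgebra of
`ℂ[a_0,…,a_n]` of polynomials invariant under the `SL(2,ℂ)`-action. -/
def invariantRing (n : ℕ) : Subalgebra ℂ (MvPolynomial (Fin (n+1)) ℂ) where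
  carrier := {p | ∀ g : Matrix.SpecialLinearGroup (Fin 2) ℂ, ∀ a : Fin (n+1) → ℂ,
    eval (sl2Act n g a) p = eval a p}
  mul_mem' := by
    intro p q hp hq g a
    simp only [Set.mem_setOf_eq, map_mul] at *
    rw [hp g a, hq g a]
  add_mem' := by
    intro p q hp hq g a
    simp only [Set.mem_setOf_eq, map_add] at *
    rw [hp g a, hq g a]
  algebraMap_mem' := by
    intro c g a
    simp

/-- `IsHSOP n d p` says that `p` is a homogeneous system of parameters of the invariant
ring of the binary form of degree `n`, with degree sequence `d` : the `p k` are
homogeneous of positive degrees `d k`, algebraically independent over `ℂ`, and `I_n` is a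
finitely generated module over the subalgebra they generate. -/
def IsHSOP (n : ℕ) (d : Fin (n-2) → ℕ) (p : Fin (n-2) → invariantRing n) : Prop :=
  (∀ k, 0 < d k) ∧
  (∀ k, ((p k : MvPolynomial (Fin (n+1)) ℂ)).IsHomogeneous (d k)) ∧
  AlgebraicIndependent ℂ p ∧
  Module.Finite (Algebra.adjoin ℂ (Set.range p)) (invariantRing n)

/-- The quintic coefficients of `∑ (5 choose i) b i x^(5-i) y^i` after the substitution
`x ↦ p x + q y`, `y ↦ r x + s y`, again normalised by binomial coefficients. -/
def quinticSubst {R : Type*} [CommRing R] (p q r s : R) (b : Fin 6 → R) : Fin 6 → R :=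
  ![b 0 * (p ^ 5) +
      b 1 * (5 * p ^ 4 * r) +
      b 2 * (10 * p ^ 3 * r ^ 2) +
      b 3 * (10 * p ^ 2 * r ^ 3) +
      b 4 * (5 * p * r ^ 4) +
      b 5 * (r ^ 5),
    b 0 * (p ^ 4 * q) +
      b 1 * (4 * p ^ 3 * r * q + p ^ 4 * s) +
      b 2 * (6 * p ^ 2 * r ^ 2 * q + 4 * p ^ 3 * r * s) +
      b 3 * (4 * p * r ^ 3 * q + 6 * p ^ 2 * r ^ 2 * s) +
      b 4 * (r ^ 4 * q + 4 * p * r ^ 3 * s) +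
      b 5 * (r ^ 4 * s),
    b 0 * (p ^ 3 * q ^ 2) +
      b 1 * (3 * p ^ 2 * r * q ^ 2 + 2 * p ^ 3 * q * s) +
      b 2 * (3 * p * r ^ 2 * q ^ 2 + 6 * p ^ 2 * r * q * s + p ^ 3 * s ^ 2) +
      b 3 * (r ^ 3 * q ^ 2 + 6 * p * r ^ 2 * q * s + 3 * p ^ 2 * r * s ^ 2) +
      b 4 * (2 * r ^ 3 * q * s + 3 * p * r ^ 2 * s ^ 2) +
      b 5 * (r ^ 3 * s ^ 2),
    b 0 * (p ^ 2 * q ^ 3) +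
      b 1 * (2 * p * r * q ^ 3 + 3 * p ^ 2 * q ^ 2 * s) +
      b 2 * (r ^ 2 * q ^ 3 + 6 * p * r * q ^ 2 * s + 3 * p ^ 2 * q * s ^ 2) +
      b 3 * (3 * r ^ 2 * q ^ 2 * s + 6 * p * r * q * s ^ 2 + p ^ 2 * s ^ 3) +
      b 4 * (3 * r ^ 2 * q * s ^ 2 + 2 * p * r * s ^ 3) +
      b 5 * (r ^ 2 * s ^ 3),
    b 0 * (p * q ^ 4) +
      b 1 * (r * q ^ 4 + 4 * p * q ^ 3 * s) +
      b 2 * (4 * r * q ^ 3 * s + 6 * p * q ^ 2 * s ^ 2) +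
      b 3 * (6 * r * q ^ 2 * s ^ 2 + 4 * p * q * s ^ 3) +
      b 4 * (4 * r * q * s ^ 3 + p * s ^ 4) +
      b 5 * (r * s ^ 4),
    b 0 * (q ^ 5) +
      b 1 * (5 * q ^ 4 * s) +
      b 2 * (10 * q ^ 3 * s ^ 2) +
      b 3 * (10 * q ^ 2 * s ^ 3) +
      b 4 * (5 * q * s ^ 4) +
      b 5 * (s ^ 5)]

/-- Substitution in the quadratic form `u 0 x² + u 1 x y + u 2 y²`. -/
def quadraticSubst {R : Type*} [CommRing R] (p q r s : R) (u : Fin 3 → R) : Fin 3 → R :=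
  ![u 0 * p ^ 2 + u 1 * (p * r) + u 2 * r ^ 2,
    2 * u 0 * (p * q) + u 1 * (p * s + q * r) + 2 * u 2 * (r * s),
    u 0 * q ^ 2 + u 1 * (q * s) + u 2 * s ^ 2]

/-- Substitution in the cubic form `∑ (3 choose i) c i x^(3-i) y^i`. -/
def cubicSubst {R : Type*} [CommRing R] (p q r s : R) (c : Fin 4 → R) : Fin 4 → R :=
  ![c 0 * p ^ 3 + 3 * c 1 * (p ^ 2 * r) + 3 * c 2 * (p * r ^ 2) + c 3 * r ^ 3,
    c 0 * (p ^ 2 * q) + c 1 * (p ^ 2 * s + 2 * p * q * r) + c 2 * (2 * p * r * s + q * r ^ 2) +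
      c 3 * (r ^ 2 * s),
    c 0 * (p * q ^ 2) + c 1 * (q ^ 2 * r + 2 * p * q * s) + c 2 * (2 * q * r * s + p * s ^ 2) +
      c 3 * (r * s ^ 2),
    c 0 * q ^ 3 + 3 * c 1 * (q ^ 2 * s) + 3 * c 2 * (q * s ^ 2) + c 3 * s ^ 3]

/-- Substitution in the linear form `l 0 x + l 1 y`. -/
def linearSubst {R : Type*} [CommRing R] (p q r s : R) (l : Fin 2 → R) : Fin 2 → R :=
  ![l 0 * p + l 1 * r, l 0 * q + l 1 * s]

/-- The quadratic covariant of degree two of a quintic. -/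
def quadraticCov {R : Type*} [CommRing R] (b : Fin 6 → R) : Fin 3 → R :=
  ![b 0 * b 4 - 4 * b 1 * b 3 + 3 * b 2 ^ 2,
    b 0 * b 5 - 3 * b 1 * b 4 + 2 * b 2 * b 3,
    b 1 * b 5 - 4 * b 2 * b 4 + 3 * b 3 ^ 2]

/-- The second transvectant of a quintic and a quadratic form. -/
def quinticTransvectant {R : Type*} [CommRing R] (b : Fin 6 → R) (u : Fin 3 → R) : Fin 4 → R :=
  ![b 0 * u 2 - b 1 * u 1 + b 2 * u 0, b 1 * u 2 - b 2 * u 1 + b 3 * u 0,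
    b 2 * u 2 - b 3 * u 1 + b 4 * u 0, b 3 * u 2 - b 4 * u 1 + b 5 * u 0]

/-- The Hessian of a cubic form. -/
def cubicHessian {R : Type*} [CommRing R] (c : Fin 4 → R) : Fin 3 → R :=
  ![c 0 * c 2 - c 1 ^ 2, c 0 * c 3 - c 1 * c 2, c 1 * c 3 - c 2 ^ 2]

/-- The second transvectant of a cubic form and a quadratic form. -/
def cubicTransvectant {R : Type*} [CommRing R] (c : Fin 4 → R) (u : Fin 3 → R) : Fin 2 → R :=
  ![c 0 * u 2 - c 1 * u 1 + c 2 * u 0, c 1 * u 2 - c 2 * u 1 + c 3 * u 0]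

/-- The Jacobian of two quadratic forms. -/
def quadraticJacobian {R : Type*} [CommRing R] (u v : Fin 3 → R) : Fin 3 → R :=
  ![u 0 * v 1 - u 1 * v 0, 2 * (u 0 * v 2 - u 2 * v 0), u 1 * v 2 - u 2 * v 1]

/-- The polarised discriminant of two quadratic forms. -/
def quadraticPairing {R : Type*} [CommRing R] (u v : Fin 3 → R) : R :=
  2 * u 0 * v 2 + 2 * u 2 * v 0 - u 1 * v 1

/-- The value of a quadratic form at the zero of a linear form. -/
def quadraticAtZero {R : Type*} [CommRing R] (u : Fin 3 → R) (l : Fin 2 → R) : R :=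
  u 0 * l 1 ^ 2 - u 1 * (l 0 * l 1) + u 2 * l 0 ^ 2

/-- The cubic covariant of degree three (canonizant) of a quintic. -/
def canonizant {R : Type*} [CommRing R] (b : Fin 6 → R) : Fin 4 → R :=
  quinticTransvectant b (quadraticCov b)

/-- The invariant of degree four. -/
def inv4 {R : Type*} [CommRing R] (b : Fin 6 → R) : R :=
  quadraticCov b 1 ^ 2 - 4 * quadraticCov b 0 * quadraticCov b 2

/-- The invariant of degree eight. -/
def inv8 {R : Type*} [CommRing R] (b : Fin 6 → R) : R :=
  quadraticPairing (quadraticCov b) (cubicHessian (canonizant b))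

/-- The invariant of degree twelve, the discriminant of the canonizant. -/
def inv12 {R : Type*} [CommRing R] (b : Fin 6 → R) : R :=
  4 * cubicHessian (canonizant b) 0 * cubicHessian (canonizant b) 2 -
    cubicHessian (canonizant b) 1 ^ 2

/-- The invariant of degree eighteen. -/
def inv18 {R : Type*} [CommRing R] (b : Fin 6 → R) : R :=
  quadraticAtZero (quadraticJacobian (quadraticCov b) (cubicHessian (canonizant b)))
    (cubicTransvectant (canonizant b) (quadraticCov b))

section Covariance

variable {R : Type*} [CommRing R] {p q r s : R}

lemma quadraticCov_subst (h : p * s - q * r = 1) (b : Fin 6 → R) :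
    quadraticCov (quinticSubst p q r s b) = quadraticSubst p q r s (quadraticCov b) := by
  have key : quadraticCov (quinticSubst p q r s b) =
      (p * s - q * r) ^ 4 • quadraticSubst p q r s (quadraticCov b) := by
    ext i
    fin_cases i <;> simp [quadraticCov, quinticSubst, quadraticSubst] <;> ring
  rw [key, h, one_pow, one_smul]

lemma quinticTransvectant_subst (h : p * s - q * r = 1) (b : Fin 6 → R) (u : Fin 3 → R) :
    quinticTransvectant (quinticSubst p q r s b) (quadraticSubst p q r s u) =
      cubicSubst p q r s (quinticTransvectant b u) := by
  have key : quinticTransvectant (quinticSubst p q r s b) (quadraticSubst p q r s u) =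
      (p * s - q * r) ^ 2 • cubicSubst p q r s (quinticTransvectant b u) := by
    ext i
    fin_cases i <;>
      simp [quinticTransvectant, quinticSubst, quadraticSubst, cubicSubst] <;> ring
  rw [key, h, one_pow, one_smul]

lemma cubicHessian_subst (h : p * s - q * r = 1) (c : Fin 4 → R) :
    cubicHessian (cubicSubst p q r s c) = quadraticSubst p q r s (cubicHessian c) := by
  have key : cubicHessian (cubicSubst p q r s c) =
      (p * s - q * r) ^ 2 • quadraticSubst p q r s (cubicHessian c) := by
    ext i
    fin_cases i <;> simp [cubicHessian, quadraticSubst, cubicSubst] <;> ring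
  rw [key, h, one_pow, one_smul]

lemma cubicTransvectant_subst (h : p * s - q * r = 1) (c : Fin 4 → R) (u : Fin 3 → R) :
    cubicTransvectant (cubicSubst p q r s c) (quadraticSubst p q r s u) =
      linearSubst p q r s (cubicTransvectant c u) := by
  have key : cubicTransvectant (cubicSubst p q r s c) (quadraticSubst p q r s u) =
      (p * s - q * r) ^ 2 • linearSubst p q r s (cubicTransvectant c u) := by
    ext i
    fin_cases i <;>
      simp [cubicTransvectant, linearSubst, quadraticSubst, cubicSubst] <;> ring
  rw [key, h, one_pow, one_smul]

lemma quadraticJacobian_subst (h : p * s - q * r = 1) (u v : Fin 3 → R) :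
    quadraticJacobian (quadraticSubst p q r s u) (quadraticSubst p q r s v) =
      quadraticSubst p q r s (quadraticJacobian u v) := by
  have key : quadraticJacobian (quadraticSubst p q r s u) (quadraticSubst p q r s v) =
      (p * s - q * r) • quadraticSubst p q r s (quadraticJacobian u v) := by
    ext i
    fin_cases i <;> simp [quadraticJacobian, quadraticSubst] <;> ring
  rw [key, h, one_smul]

lemma quadraticPairing_subst (h : p * s - q * r = 1) (u v : Fin 3 → R) :
    quadraticPairing (quadraticSubst p q r s u) (quadraticSubst p q r s v) =
      quadraticPairing u v := by
  have key : quadraticPairing (quadraticSubst p q r s u) (quadraticSubst p q r s v) =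
      (p * s - q * r) ^ 2 * quadraticPairing u v := by
    simp [quadraticPairing, quadraticSubst]; ring
  rw [key, h, one_pow, one_mul]

lemma quadraticAtZero_subst (h : p * s - q * r = 1) (u : Fin 3 → R) (l : Fin 2 → R) :
    quadraticAtZero (quadraticSubst p q r s u) (linearSubst p q r s l) =
      quadraticAtZero u l := by
  have key : quadraticAtZero (quadraticSubst p q r s u) (linearSubst p q r s l) =
      (p * s - q * r) ^ 2 * quadraticAtZero u l := by
    simp [quadraticAtZero, quadraticSubst, linearSubst]; ring
  rw [key, h, one_pow, one_mul]

lemma canonizant_subst (h : p * s - q * r = 1) (b : Fin 6 → R) :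
    canonizant (quinticSubst p q r s b) = cubicSubst p q r s (canonizant b) := by
  rw [canonizant, quadraticCov_subst h, quinticTransvectant_subst h, canonizant]

lemma inv4_eq_neg_pairing (b : Fin 6 → R) :
    inv4 b = -quadraticPairing (quadraticCov b) (quadraticCov b) := by
  simp only [inv4, quadraticPairing]; ring

lemma inv4_subst (h : p * s - q * r = 1) (b : Fin 6 → R) :
    inv4 (quinticSubst p q r s b) = inv4 b := by
  rw [inv4_eq_neg_pairing, quadraticCov_subst h, quadraticPairing_subst h, inv4_eq_neg_pairing]

lemma inv8_subst (h : p * s - q * r = 1) (b : Fin 6 → R) :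
    inv8 (quinticSubst p q r s b) = inv8 b := by
  rw [inv8, quadraticCov_subst h, canonizant_subst h, cubicHessian_subst h,
    quadraticPairing_subst h, inv8]

lemma inv12_eq_pairing (b : Fin 6 → R) :
    inv12 b = quadraticPairing (cubicHessian (canonizant b)) (cubicHessian (canonizant b)) := by
  simp only [inv12, quadraticPairing]; ring

lemma inv12_subst (h : p * s - q * r = 1) (b : Fin 6 → R) :
    inv12 (quinticSubst p q r s b) = inv12 b := by
  rw [inv12_eq_pairing, canonizant_subst h, cubicHessian_subst h, quadraticPairing_subst h,
    inv12_eq_pairing]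

lemma inv18_subst (h : p * s - q * r = 1) (b : Fin 6 → R) :
    inv18 (quinticSubst p q r s b) = inv18 b := by
  rw [inv18, quadraticCov_subst h, canonizant_subst h, cubicHessian_subst h,
    quadraticJacobian_subst h, cubicTransvectant_subst h, quadraticAtZero_subst h, inv18]

end Covariance

lemma map_inv4 {R S : Type*} [CommRing R] [CommRing S] (f : R →+* S) (b : Fin 6 → R) :
    f (inv4 b) = inv4 (fun i => f (b i)) := by
  simp [inv4, quadraticCov, map_ofNat]

lemma map_inv8 {R S : Type*} [CommRing R] [CommRing S] (f : R →+* S) (b : Fin 6 → R) :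
    f (inv8 b) = inv8 (fun i => f (b i)) := by
  simp [inv8, quadraticPairing, cubicHessian, canonizant, quinticTransvectant, quadraticCov,
    map_ofNat]

lemma map_inv12 {R S : Type*} [CommRing R] [CommRing S] (f : R →+* S) (b : Fin 6 → R) :
    f (inv12 b) = inv12 (fun i => f (b i)) := by
  simp [inv12, cubicHessian, canonizant, quinticTransvectant, quadraticCov,
    map_ofNat]

lemma map_inv18 {R S : Type*} [CommRing R] [CommRing S] (f : R →+* S) (b : Fin 6 → R) :
    f (inv18 b) = inv18 (fun i => f (b i)) := by
  simp [inv18, quadraticAtZero, quadraticJacobian, cubicTransvectant, cubicHessian, canonizant,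
    quinticTransvectant, quadraticCov,
    map_ofNat]

/-- The coefficients of a quintic, divided by the binomial coefficients. -/
def normalise (a : Fin 6 → ℂ) : Fin 6 → ℂ :=
  ![a 0, a 1 / 5, a 2 / 10, a 3 / 10, a 4 / 5, a 5]

/-- The inverse of `normalise`. -/
def denormalise {R : Type*} [CommRing R] (b : Fin 6 → R) : Fin 6 → R :=
  ![b 0, 5 * b 1, 10 * b 2, 10 * b 3, 5 * b 4, b 5]

lemma normalise_denormalise (b : Fin 6 → ℂ) : normalise (denormalise b) = b := by
  ext i
  fin_cases i <;> simp [normalise, denormalise]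

lemma denormalise_normalise (a : Fin 6 → ℂ) : denormalise (normalise a) = a := by
  ext i
  fin_cases i <;> simp [normalise, denormalise] <;> ring

lemma coeff_formPoly (n : ℕ) (a : Fin (n + 1) → ℂ) (i : Fin (n + 1)) :
    coeff (Finsupp.single 0 (n - (i : ℕ)) + Finsupp.single 1 (i : ℕ)) (formPoly n a) = a i := by
  have h : ∀ j : Fin (n + 1), C (a j) * X 0 ^ (n - (j : ℕ)) * X 1 ^ (j : ℕ) =
      monomial (Finsupp.single (0 : Fin 2) (n - (j : ℕ)) + Finsupp.single 1 (j : ℕ)) (a j) := by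
    intro j
    rw [X_pow_eq_monomial, X_pow_eq_monomial, C_mul_monomial, monomial_mul, mul_one, mul_one]
  simp only [formPoly, h, coeff_sum, coeff_monomial]
  rw [Finset.sum_eq_single i]
  · simp
  · intro j _ hj
    rw [if_neg]
    intro he
    apply hj
    have := DFunLike.congr_fun he 1
    simp at this
    exact Fin.ext this
  · simp

lemma coeff_rename_formPoly (n : ℕ) (a : Fin (n + 1) → ℂ) (i : Fin (n + 1)) :
    coeff (Finsupp.single 0 (n - (i : ℕ)) + Finsupp.single 1 (i : ℕ))
      (rename (Fin.val : Fin 2 → ℕ) (formPoly n a)) = a i := by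
  have h : Finsupp.single 0 (n - (i : ℕ)) + Finsupp.single 1 (i : ℕ) =
      Finsupp.mapDomain (Fin.val : Fin 2 → ℕ)
        (Finsupp.single 0 (n - (i : ℕ)) + Finsupp.single 1 (i : ℕ)) := by
    generalize n - (i : ℕ) = k
    simp [Finsupp.mapDomain_add, Finsupp.mapDomain_single]
  rw [h, coeff_rename_mapDomain _ Fin.val_injective, coeff_formPoly]

lemma bind₁_formPoly (p q : Fin 2 → ℂ) (a : Fin 6 → ℂ) :
    bind₁ (fun j => C (p j) * X 0 + C (q j) * X 1 : Fin 2 → MvPolynomial ℕ ℂ) (formPoly 5 a) =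
      rename Fin.val (formPoly 5
        (denormalise (quinticSubst (p 0) (q 0) (p 1) (q 1) (normalise a)))) := by
  conv_lhs => rw [← denormalise_normalise a]
  simp [formPoly, Fin.sum_univ_succ, denormalise, quinticSubst, map_ofNat]
  ring

lemma sl2Act_eq (g : Matrix.SpecialLinearGroup (Fin 2) ℂ) (a : Fin 6 → ℂ) :
    sl2Act 5 g a =
      denormalise (quinticSubst (g.1 0 0) (g.1 0 1) (g.1 1 0) (g.1 1 1) (normalise a)) := by
  funext i
  rw [← coeff_rename_formPoly 5 (denormalise _) i,
    ← bind₁_formPoly (fun j => g.1 j 0) (fun j => g.1 j 1)]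
  rfl

/-- The coefficients, normalised by binomials, of `u x^5 + v y^5 + w (-x-y)^5`. -/
def sylvester {R : Type*} [CommRing R] (u v w : R) : Fin 6 → R :=
  ![u - w, -w, -w, -w, -w, v - w]

section Sylvester

variable {R : Type*} [CommRing R] (u v w : R)

lemma quadraticCov_sylvester :
    quadraticCov (sylvester u v w) = ![-(u * w), u * v - u * w - v * w, -(v * w)] := by
  ext i
  fin_cases i <;> simp [quadraticCov, sylvester] <;> ring

lemma canonizant_sylvester :
    canonizant (sylvester u v w) = ![0, u * v * w, u * v * w, 0] := by
  rw [canonizant, quadraticCov_sylvester]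
  ext i
  fin_cases i <;> simp [quinticTransvectant, sylvester] <;> ring

lemma cubicHessian_canonizant_sylvester :
    cubicHessian (canonizant (sylvester u v w)) = fun _ => -(u * v * w) ^ 2 := by
  rw [canonizant_sylvester]
  ext i
  fin_cases i <;> simp [cubicHessian] <;> ring

lemma inv4_sylvester :
    inv4 (sylvester u v w) =
      (u * v + u * w + v * w) ^ 2 - 4 * (u + v + w) * (u * v * w) := by
  simp [inv4, quadraticCov_sylvester]
  ring

lemma inv8_sylvester :
    inv8 (sylvester u v w) = (u * v * w) ^ 2 * (u * v + u * w + v * w) := by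
  simp [inv8, quadraticPairing, cubicHessian_canonizant_sylvester, quadraticCov_sylvester]
  ring

lemma inv12_sylvester : inv12 (sylvester u v w) = 3 * (u * v * w) ^ 4 := by
  simp [inv12, cubicHessian_canonizant_sylvester]
  ring

lemma inv18_sylvester :
    inv18 (sylvester u v w) = 3 * (u * v * w) ^ 5 * ((u - w) * (v - w) * (v - u)) := by
  rw [inv18, cubicHessian_canonizant_sylvester]
  simp [quadraticAtZero, quadraticJacobian, cubicTransvectant, canonizant_sylvester,
    quadraticCov_sylvester]
  ring

lemma sylvester_cycle :
    quinticSubst 0 1 (-1) (-1) (sylvester u v w) = sylvester w u v := by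
  ext i
  fin_cases i <;> simp [quinticSubst, sylvester] <;> ring

end Sylvester

lemma sylvester_swap (u v w : ℂ) :
    quinticSubst 0 Complex.I Complex.I 0 (sylvester u v w) = Complex.I • sylvester v u w := by
  have h3 : Complex.I ^ 5 = Complex.I := by
    rw [show Complex.I ^ 5 = (Complex.I ^ 2) ^ 2 * Complex.I by ring, Complex.I_sq]; ring
  ext i
  fin_cases i <;> simp [quinticSubst, sylvester] <;> ring_nf

lemma inv_syzygy_sylvester {R : Type*} [CommRing R] (u v w : R) :
    16 * inv18 (sylvester u v w) ^ 2 =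
      inv4 (sylvester u v w) *
          (3 * inv8 (sylvester u v w) ^ 2 - inv12 (sylvester u v w) * inv4 (sylvester u v w)) ^ 2 +
        24 * inv8 (sylvester u v w) ^ 3 * inv12 (sylvester u v w) -
        72 * inv8 (sylvester u v w) * inv4 (sylvester u v w) * inv12 (sylvester u v w) ^ 2 -
        144 * inv12 (sylvester u v w) ^ 3 := by
  rw [inv4_sylvester, inv8_sylvester, inv12_sylvester, inv18_sylvester]
  ring

lemma canonizant_apolar {R : Type*} [CommRing R] (b : Fin 6 → R) :
    canonizant b 0 * b 3 - 3 * canonizant b 1 * b 2 + 3 * canonizant b 2 * b 1 -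
        canonizant b 3 * b 0 = 0 ∧
    canonizant b 0 * b 4 - 3 * canonizant b 1 * b 3 + 3 * canonizant b 2 * b 2 -
        canonizant b 3 * b 1 = 0 ∧
    canonizant b 0 * b 5 - 3 * canonizant b 1 * b 4 + 3 * canonizant b 2 * b 3 -
        canonizant b 3 * b 2 = 0 := by
  refine ⟨?_, ?_, ?_⟩ <;> simp [canonizant, quinticTransvectant, quadraticCov] <;> ring

lemma exists_root_cubic {a : ℂ} (ha : a ≠ 0) (b c d : ℂ) :
    ∃ t : ℂ, a * t ^ 3 + b * t ^ 2 + c * t + d = 0 := by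
  obtain ⟨t, ht⟩ := IsAlgClosed.exists_root
    (Polynomial.C a * Polynomial.X ^ 3 + Polynomial.C b * Polynomial.X ^ 2 +
      Polynomial.C c * Polynomial.X + Polynomial.C d)
    (by rw [Polynomial.degree_cubic ha]; decide)
  exact ⟨t, by simpa [Polynomial.IsRoot] using ht⟩

lemma exists_root_quadratic {a : ℂ} (ha : a ≠ 0) (b c : ℂ) :
    ∃ t : ℂ, a * t ^ 2 + b * t + c = 0 := by
  obtain ⟨t, ht⟩ := IsAlgClosed.exists_root
    (Polynomial.C a * Polynomial.X ^ 2 + Polynomial.C b * Polynomial.X + Polynomial.C c)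
    (by rw [Polynomial.degree_quadratic ha]; decide)
  exact ⟨t, by simpa [Polynomial.IsRoot] using ht⟩

/-- A quintic whose canonizant has no repeated root is equivalent to a sum of three fifth powers
of linear forms summing to zero. -/
lemma sylvester_induction {P : (Fin 6 → ℂ) → Prop}
    (hP : ∀ p q r s : ℂ, p * s - q * r = 1 → ∀ b, P (quinticSubst p q r s b) → P b)
    (hS : ∀ u v w, P (sylvester u v w)) (b : Fin 6 → ℂ) (hb : inv12 b ≠ 0) : P b := by
  have balanced : ∀ b : Fin 6 → ℂ, inv12 b ≠ 0 → canonizant b 0 = 0 → canonizant b 3 = 0 →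
      canonizant b 1 = canonizant b 2 → P b := by
    intro b hb h0 h3 h12
    have h2 : canonizant b 2 ≠ 0 := by
      intro h
      apply hb
      simp [inv12, cubicHessian, h0, h12, h]
    obtain ⟨e1, e2, e3⟩ := canonizant_apolar b
    rw [h0, h3, h12] at e1 e2 e3
    have e1' : b 2 = b 1 := mul_left_cancel₀ h2 (by linear_combination -e1 / 3)
    have e2' : b 3 = b 1 := mul_left_cancel₀ h2 (by rw [e1'] at e2; linear_combination -e2 / 3)
    have e3' : b 4 = b 1 := mul_left_cancel₀ h2 (by rw [e2'] at e3; linear_combination -e3 / 3)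
    have : b = sylvester (b 0 - b 1) (b 5 - b 1) (-b 1) := by
      ext i
      fin_cases i <;> simp [sylvester, e1', e2', e3']
    rw [this]
    exact hS _ _ _
  have two_roots : ∀ b : Fin 6 → ℂ, inv12 b ≠ 0 → canonizant b 0 = 0 → canonizant b 3 = 0 →
      P b := by
    intro b hb h0 h3
    have h1 : canonizant b 1 ≠ 0 := by
      intro h
      apply hb
      simp [inv12, cubicHessian, h0, h3, h]
    have h2 : canonizant b 2 ≠ 0 := by
      intro h
      apply hb
      simp [inv12, cubicHessian, h0, h3, h]
    obtain ⟨z, hz⟩ := IsAlgClosed.exists_pow_nat_eq (canonizant b 2 / canonizant b 1) two_pos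
    have hz0 : z ≠ 0 := by
      rintro rfl
      have := div_ne_zero h2 h1
      simp [← hz] at this
    have hdet : z * z⁻¹ - 0 * 0 = 1 := by simp [hz0]
    refine hP z 0 0 z⁻¹ hdet b (balanced _ ?_ ?_ ?_ ?_)
    · rwa [inv12_subst hdet]
    · simp [canonizant_subst hdet, cubicSubst, h0]
    · simp [canonizant_subst hdet, cubicSubst, h3]
    · rw [canonizant_subst hdet]
      simp only [cubicSubst, h0, h3, Matrix.cons_val]
      have : canonizant b 1 * z ^ 2 = canonizant b 2 := by rw [hz]; field_simp
      field_simp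
      linear_combination z * this
  have one_root : ∀ b : Fin 6 → ℂ, inv12 b ≠ 0 → canonizant b 0 = 0 → P b := by
    intro b hb h0
    have h1 : canonizant b 1 ≠ 0 := by
      intro h
      apply hb
      simp [inv12, cubicHessian, h0, h]
    obtain ⟨t, ht⟩ := exists_root_quadratic h1 (canonizant b 2) (canonizant b 3 / 3)
    have hdet : (1 : ℂ) * 1 - t * 0 = 1 := by simp
    refine hP 1 t 0 1 hdet b (two_roots _ ?_ ?_ ?_)
    · rwa [inv12_subst hdet]
    · simp [canonizant_subst hdet, cubicSubst, h0]
    · rw [canonizant_subst hdet]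
      simp only [cubicSubst, h0, Matrix.cons_val]
      linear_combination 3 * ht
  by_cases h0 : canonizant b 0 = 0
  · exact one_root b hb h0
  obtain ⟨t, ht⟩ := exists_root_cubic h0 (3 * canonizant b 1) (3 * canonizant b 2) (canonizant b 3)
  have hdet : t * 0 - (-1) * 1 = 1 := by simp
  refine hP t (-1) 1 0 hdet b (one_root _ ?_ ?_)
  · rwa [inv12_subst hdet]
  · rw [canonizant_subst hdet]
    simp only [cubicSubst, Matrix.cons_val]
    linear_combination ht

lemma exists_sylvester_of_esymm (s₁ s₂ s₃ : ℂ) :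
    ∃ u v w : ℂ, u + v + w = s₁ ∧ u * v + u * w + v * w = s₂ ∧ u * v * w = s₃ := by
  obtain ⟨u, hu⟩ := exists_root_cubic one_ne_zero (-s₁) s₂ (-s₃)
  obtain ⟨v, hv⟩ := exists_root_quadratic one_ne_zero (-(s₁ - u)) (s₂ - u * (s₁ - u))
  refine ⟨u, v, s₁ - u - v, by ring, by linear_combination -hv, ?_⟩
  linear_combination -u * hv + hu

lemma exists_inv_eq (x y z : ℂ) :
    ∃ b : Fin 6 → ℂ, inv4 b = x ∧ inv8 b = y ∧ inv12 b = z := by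
  by_cases hz : z = 0
  · obtain ⟨b₀, h₀⟩ := IsAlgClosed.exists_pow_nat_eq x two_pos
    obtain ⟨b₁, h₁⟩ := IsAlgClosed.exists_pow_nat_eq (-y / 2) (show 0 < 5 by norm_num)
    refine ⟨![b₀, b₁, 0, 0, 0, 1], ?_, ?_, ?_⟩
    · simp [inv4, quadraticCov, h₀]
    · simp [inv8, quadraticPairing, cubicHessian, canonizant, quinticTransvectant, quadraticCov]
      linear_combination -2 * h₁
    · simp [inv12, cubicHessian, canonizant, quinticTransvectant, quadraticCov, hz]
  · obtain ⟨s, hs⟩ := IsAlgClosed.exists_pow_nat_eq (z / 3) (show 0 < 4 by norm_num)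
    have hs0 : s ≠ 0 := by
      rintro rfl
      apply hz
      simpa using hs.symm
    obtain ⟨u, v, w, h1, h2, h3⟩ :=
      exists_sylvester_of_esymm (((y / s ^ 2) ^ 2 - x) / (4 * s)) (y / s ^ 2) s
    refine ⟨sylvester u v w, ?_, ?_, ?_⟩
    · rw [inv4_sylvester, h1, h2, h3]
      field_simp
      ring
    · rw [inv8_sylvester, h2, h3]
      field_simp
    · rw [inv12_sylvester, h3, hs]
      ring

/-- The coordinates on quintics, normalised by binomial coefficients. -/
def genericQuintic : Fin 6 → MvPolynomial (Fin 6) ℂ :=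
  ![X 0, C (1 / 5) * X 1, C (1 / 10) * X 2, C (1 / 10) * X 3, C (1 / 5) * X 4, X 5]

lemma eval_genericQuintic (a : Fin 6 → ℂ) :
    (fun i => eval a (genericQuintic i)) = normalise a := by
  funext i
  fin_cases i <;> simp [genericQuintic, normalise] <;> ring

lemma eval_inv4 (a : Fin 6 → ℂ) : eval a (inv4 genericQuintic) = inv4 (normalise a) := by
  rw [map_inv4, eval_genericQuintic]

lemma eval_inv8 (a : Fin 6 → ℂ) : eval a (inv8 genericQuintic) = inv8 (normalise a) := by
  rw [map_inv8, eval_genericQuintic]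

lemma eval_inv12 (a : Fin 6 → ℂ) : eval a (inv12 genericQuintic) = inv12 (normalise a) := by
  rw [map_inv12, eval_genericQuintic]

lemma eval_inv18 (a : Fin 6 → ℂ) : eval a (inv18 genericQuintic) = inv18 (normalise a) := by
  rw [map_inv18, eval_genericQuintic]

lemma normalise_smul (t : ℂ) (a : Fin 6 → ℂ) : normalise (t • a) = t • normalise a := by
  ext i
  fin_cases i <;> simp [normalise, mul_div_assoc]

lemma denormalise_smul (t : ℂ) (b : Fin 6 → ℂ) : denormalise (t • b) = t • denormalise b := by
  ext i
  fin_cases i <;> simp [denormalise, mul_left_comm]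

section Scaling

variable {R : Type*} [CommRing R] (t : R) (b : Fin 6 → R)

lemma quinticSubst_smul (p q r s : R) :
    quinticSubst p q r s (t • b) = t • quinticSubst p q r s b := by
  ext i
  fin_cases i <;> simp [quinticSubst] <;> ring

lemma quadraticCov_smul : quadraticCov (t • b) = t ^ 2 • quadraticCov b := by
  ext i
  fin_cases i <;> simp [quadraticCov] <;> ring

lemma canonizant_smul : canonizant (t • b) = t ^ 3 • canonizant b := by
  rw [canonizant, quadraticCov_smul, canonizant]
  ext i
  fin_cases i <;> simp [quinticTransvectant] <;> ring

lemma cubicHessian_smul (c : Fin 4 → R) : cubicHessian (t • c) = t ^ 2 • cubicHessian c := by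
  ext i
  fin_cases i <;> simp [cubicHessian] <;> ring

lemma inv4_smul : inv4 (t • b) = t ^ 4 * inv4 b := by
  simp only [inv4, quadraticCov_smul, Pi.smul_apply, smul_eq_mul]
  ring

lemma inv8_smul : inv8 (t • b) = t ^ 8 * inv8 b := by
  simp only [inv8, quadraticPairing, quadraticCov_smul, canonizant_smul, cubicHessian_smul,
    Pi.smul_apply, smul_eq_mul]
  ring

lemma inv12_smul : inv12 (t • b) = t ^ 12 * inv12 b := by
  simp only [inv12, canonizant_smul, cubicHessian_smul, Pi.smul_apply, smul_eq_mul]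
  ring

lemma inv18_smul : inv18 (t • b) = t ^ 18 * inv18 b := by
  simp only [inv18, quadraticAtZero, quadraticJacobian, cubicTransvectant, quadraticCov_smul,
    canonizant_smul, cubicHessian_smul, Pi.smul_apply, smul_eq_mul, Matrix.cons_val]
  ring

end Scaling

lemma MvPolynomial.IsHomogeneous.eval_smul {σ R : Type*} [CommRing R] {P : MvPolynomial σ R}
    {d : ℕ} (hP : P.IsHomogeneous d) (t : R) (a : σ → R) :
    eval (t • a) P = t ^ d * eval a P := by
  rw [eval_eq, eval_eq, Finset.mul_sum]
  refine Finset.sum_congr rfl fun m hm => ?_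
  have hd : ∑ i ∈ m.support, m i = d := by
    rw [← hP (mem_support_iff.mp hm), Finsupp.weight_apply, Finsupp.sum]
    simp
  simp only [Pi.smul_apply, smul_eq_mul, mul_pow, Finset.prod_mul_distrib,
    Finset.prod_pow_eq_pow_sum, hd]
  ring

/-- The restriction of a polynomial function to a line through the origin. -/
def lineRestriction {σ : Type*} (P : MvPolynomial σ ℂ) (a : σ → ℂ) : Polynomial ℂ :=
  ∑ d ∈ Finset.range (P.totalDegree + 1),
    Polynomial.C (eval a (homogeneousComponent d P)) * Polynomial.X ^ d

lemma eval_lineRestriction {σ : Type*} (P : MvPolynomial σ ℂ) (a : σ → ℂ) (t : ℂ) :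
    (lineRestriction P a).eval t = eval (t • a) P := by
  conv_rhs => rw [← sum_homogeneousComponent P]
  simp only [lineRestriction, Polynomial.eval_finsetSum, map_sum, Polynomial.eval_mul,
    Polynomial.eval_C, Polynomial.eval_pow, Polynomial.eval_X]
  refine Finset.sum_congr rfl fun d _ => ?_
  rw [(homogeneousComponent_isHomogeneous d P).eval_smul, mul_comm]

lemma coeff_lineRestriction {σ : Type*} (P : MvPolynomial σ ℂ) (a : σ → ℂ) (d : ℕ) :
    (lineRestriction P a).coeff d = eval a (homogeneousComponent d P) := by
  simp only [lineRestriction, Polynomial.finsetSum_coeff, Polynomial.coeff_C_mul_X_pow]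
  rw [Finset.sum_ite_eq, ite_eq_left_iff]
  intro h
  rw [homogeneousComponent_eq_zero, map_zero]
  simpa using h

lemma isHomogeneous_of_eval_smul {σ : Type*} {P : MvPolynomial σ ℂ} {n : ℕ}
    (h : ∀ (t : ℂ) (a : σ → ℂ), eval (t • a) P = t ^ n * eval a P) : P.IsHomogeneous n := by
  have key : homogeneousComponent n P = P := by
    apply MvPolynomial.funext
    intro a
    have : lineRestriction P a = Polynomial.C (eval a P) * Polynomial.X ^ n := by
      apply Polynomial.funext
      intro t
      rw [eval_lineRestriction, h, Polynomial.eval_mul, Polynomial.eval_C, Polynomial.eval_pow,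
        Polynomial.eval_X, mul_comm]
    rw [← coeff_lineRestriction, this, Polynomial.coeff_C_mul_X_pow, if_pos rfl]
  rw [← key]
  exact homogeneousComponent_isHomogeneous n P

lemma mem_invariantRing_iff {P : MvPolynomial (Fin 6) ℂ} :
    P ∈ invariantRing 5 ↔ ∀ p q r s : ℂ, p * s - q * r = 1 → ∀ b,
      eval (denormalise (quinticSubst p q r s b)) P = eval (denormalise b) P := by
  constructor
  · intro hP p q r s h b
    let g : Matrix.SpecialLinearGroup (Fin 2) ℂ :=
      ⟨!![p, q; r, s], by rw [Matrix.det_fin_two_of, h]⟩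
    have e := sl2Act_eq g (denormalise b)
    rw [normalise_denormalise] at e
    exact (congrArg (fun a => eval a P) e).symm.trans (hP g (denormalise b))
  · intro hP g a
    have hg : g.1 0 0 * g.1 1 1 - g.1 0 1 * g.1 1 0 = 1 := by
      rw [← Matrix.det_fin_two]
      exact g.2
    have := hP _ _ _ _ hg (normalise a)
    rw [denormalise_normalise] at this
    exact (congrArg (fun a => eval a P) (sl2Act_eq g a)).trans this

lemma homogeneousComponent_mem_invariantRing {P : MvPolynomial (Fin 6) ℂ}
    (hP : P ∈ invariantRing 5) (d : ℕ) : homogeneousComponent d P ∈ invariantRing 5 := by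
  rw [mem_invariantRing_iff] at hP
  refine mem_invariantRing_iff.mpr fun p q r s h b => ?_
  have key : lineRestriction P (denormalise (quinticSubst p q r s b)) =
      lineRestriction P (denormalise b) := by
    apply Polynomial.funext
    intro t
    rw [eval_lineRestriction, eval_lineRestriction, ← denormalise_smul, ← denormalise_smul,
      ← quinticSubst_smul, hP _ _ _ _ h]
  exact (coeff_lineRestriction P _ d).symm.trans
    ((congrArg (fun f => f.coeff d) key).trans (coeff_lineRestriction P _ d))

lemma eq_zero_of_eval_sylvester {P : MvPolynomial (Fin 6) ℂ} (hP : P ∈ invariantRing 5)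
    (h : ∀ u v w, eval (denormalise (sylvester u v w)) P = 0) : P = 0 := by
  rw [mem_invariantRing_iff] at hP
  have hmul : inv12 genericQuintic * P = 0 := by
    apply MvPolynomial.funext
    intro a
    rw [map_mul, eval_inv12, map_zero, mul_eq_zero, or_iff_not_imp_left]
    intro ha
    have := sylvester_induction (P := fun b => eval (denormalise b) P = 0)
      (fun p q r s hd b hb => (hP p q r s hd b).symm.trans hb) h _ ha
    rwa [denormalise_normalise] at this
  refine (mul_eq_zero.mp hmul).resolve_left fun h0 => ?_
  have := congrArg (eval (denormalise (sylvester 1 1 1))) h0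
  rw [eval_inv12, normalise_denormalise, inv12_sylvester] at this
  norm_num at this

/-- Evaluation of an invariant at a quintic given by its normalised coefficients. -/
def evalAt (b : Fin 6 → ℂ) : invariantRing 5 →ₐ[ℂ] ℂ :=
  (aeval (denormalise b)).comp (invariantRing 5).val

lemma evalAt_apply (b : Fin 6 → ℂ) (x : invariantRing 5) :
    evalAt b x = eval (denormalise b) (x : MvPolynomial (Fin 6) ℂ) := by
  rw [evalAt, AlgHom.comp_apply, aeval_eq_eval]
  rfl

lemma eq_of_evalAt_sylvester {x y : invariantRing 5}
    (h : ∀ u v w, evalAt (sylvester u v w) x = evalAt (sylvester u v w) y) : x = y := by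
  rw [← sub_eq_zero]
  apply Subtype.ext
  refine eq_zero_of_eval_sylvester (Subtype.property _) fun u v w => ?_
  rw [← evalAt_apply, map_sub, h, sub_self]

lemma eq_of_evalAt {x y : invariantRing 5} (h : ∀ b, evalAt b x = evalAt b y) : x = y :=
  eq_of_evalAt_sylvester fun _ _ _ => h _

lemma evalAt_quinticSubst {p q r s : ℂ} (h : p * s - q * r = 1) (b : Fin 6 → ℂ)
    (x : invariantRing 5) : evalAt (quinticSubst p q r s b) x = evalAt b x := by
  rw [evalAt_apply, evalAt_apply]
  exact mem_invariantRing_iff.mp x.2 p q r s h b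

lemma evalAt_smul {x : invariantRing 5} {n : ℕ}
    (hx : (x : MvPolynomial (Fin 6) ℂ).IsHomogeneous n) (t : ℂ) (b : Fin 6 → ℂ) :
    evalAt (t • b) x = t ^ n * evalAt b x := by
  rw [evalAt_apply, evalAt_apply, denormalise_smul, hx.eval_smul]

/-- The invariant of degree 4. -/
def invariantGen4 : invariantRing 5 :=
  ⟨inv4 genericQuintic, mem_invariantRing_iff.mpr fun p q r s h b => by
    rw [eval_inv4, eval_inv4, normalise_denormalise, normalise_denormalise, inv4_subst h]⟩

/-- The invariant of degree 8. -/
def invariantGen8 : invariantRing 5 :=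
  ⟨inv8 genericQuintic, mem_invariantRing_iff.mpr fun p q r s h b => by
    rw [eval_inv8, eval_inv8, normalise_denormalise, normalise_denormalise, inv8_subst h]⟩

/-- The invariant of degree 12. -/
def invariantGen12 : invariantRing 5 :=
  ⟨inv12 genericQuintic, mem_invariantRing_iff.mpr fun p q r s h b => by
    rw [eval_inv12, eval_inv12, normalise_denormalise, normalise_denormalise, inv12_subst h]⟩

/-- The invariant of degree 18. -/
def invariantGen18 : invariantRing 5 :=
  ⟨inv18 genericQuintic, mem_invariantRing_iff.mpr fun p q r s h b => by
    rw [eval_inv18, eval_inv18, normalise_denormalise, normalise_denormalise, inv18_subst h]⟩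

lemma isHomogeneous_inv4 : (inv4 genericQuintic).IsHomogeneous 4 :=
  isHomogeneous_of_eval_smul fun t a => by
    rw [eval_inv4, eval_inv4, normalise_smul, inv4_smul]

lemma isHomogeneous_inv8 : (inv8 genericQuintic).IsHomogeneous 8 :=
  isHomogeneous_of_eval_smul fun t a => by
    rw [eval_inv8, eval_inv8, normalise_smul, inv8_smul]

lemma isHomogeneous_inv12 : (inv12 genericQuintic).IsHomogeneous 12 :=
  isHomogeneous_of_eval_smul fun t a => by
    rw [eval_inv12, eval_inv12, normalise_smul, inv12_smul]

lemma isHomogeneous_inv18 : (inv18 genericQuintic).IsHomogeneous 18 :=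
  isHomogeneous_of_eval_smul fun t a => by
    rw [eval_inv18, eval_inv18, normalise_smul, inv18_smul]

lemma evalAt_invariantGen4 (b : Fin 6 → ℂ) : evalAt b invariantGen4 = inv4 b := by
  rw [evalAt_apply, invariantGen4, eval_inv4, normalise_denormalise]

lemma evalAt_invariantGen8 (b : Fin 6 → ℂ) : evalAt b invariantGen8 = inv8 b := by
  rw [evalAt_apply, invariantGen8, eval_inv8, normalise_denormalise]

lemma evalAt_invariantGen12 (b : Fin 6 → ℂ) : evalAt b invariantGen12 = inv12 b := by
  rw [evalAt_apply, invariantGen12, eval_inv12, normalise_denormalise]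

lemma evalAt_invariantGen18 (b : Fin 6 → ℂ) : evalAt b invariantGen18 = inv18 b := by
  rw [evalAt_apply, invariantGen18, eval_inv18, normalise_denormalise]

lemma inv_syzygy :
    16 * invariantGen18 ^ 2 =
      invariantGen4 * (3 * invariantGen8 ^ 2 - invariantGen12 * invariantGen4) ^ 2 +
        24 * invariantGen8 ^ 3 * invariantGen12 -
        72 * invariantGen8 * invariantGen4 * invariantGen12 ^ 2 - 144 * invariantGen12 ^ 3 := by
  refine eq_of_evalAt_sylvester fun u v w => ?_
  simpa only [map_mul, map_add, map_sub, map_pow, map_ofNat, evalAt_invariantGen4,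
    evalAt_invariantGen8, evalAt_invariantGen12, evalAt_invariantGen18] using
    inv_syzygy_sylvester u v w

lemma evalAt_sylvester_swap {x : invariantRing 5} {m : ℕ}
    (hx : (x : MvPolynomial (Fin 6) ℂ).IsHomogeneous (4 * m)) (u v w : ℂ) :
    evalAt (sylvester v u w) x = evalAt (sylvester u v w) x := by
  have hdet : (0 : ℂ) * 0 - Complex.I * Complex.I = 1 := by simp
  rw [← evalAt_quinticSubst hdet (sylvester u v w), sylvester_swap, evalAt_smul hx, pow_mul,
    Complex.I_pow_four, one_pow, one_mul]

lemma evalAt_sylvester_cycle (x : invariantRing 5) (u v w : ℂ) :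
    evalAt (sylvester w u v) x = evalAt (sylvester u v w) x := by
  have hdet : (0 : ℂ) * (-1) - 1 * (-1) = 1 := by simp
  rw [← evalAt_quinticSubst hdet (sylvester u v w), sylvester_cycle]

lemma perm_fin_three (e : Equiv.Perm (Fin 3)) :
    (e 0, e 1, e 2) ∈ [(0, 1, 2), (0, 2, 1), (1, 0, 2), (1, 2, 0), (2, 0, 1), (2, 1, 0)] := by
  revert e
  decide

lemma eval_aeval {σ τ : Type*} (a : τ → ℂ) (f : σ → MvPolynomial τ ℂ) (P : MvPolynomial σ ℂ) :
    eval a (aeval f P) = eval (fun i => eval a (f i)) P := by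
  rw [← aeval_eq_eval, ← AlgHom.comp_apply, comp_aeval, aeval_eq_eval]

/-- The restriction of an invariant to the Sylvester slice. -/
def sliceRestriction (x : invariantRing 5) : MvPolynomial (Fin 3) ℂ :=
  aeval (denormalise (sylvester (X 0) (X 1) (X 2))) (x : MvPolynomial (Fin 6) ℂ)

lemma eval_sliceRestriction (x : invariantRing 5) (a : Fin 3 → ℂ) :
    eval a (sliceRestriction x) = evalAt (sylvester (a 0) (a 1) (a 2)) x := by
  rw [evalAt_apply, sliceRestriction, eval_aeval]
  congr 2
  funext i
  fin_cases i <;> simp [denormalise, sylvester]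

lemma isSymmetric_sliceRestriction {x : invariantRing 5} {m : ℕ}
    (hx : (x : MvPolynomial (Fin 6) ℂ).IsHomogeneous (4 * m)) :
    (sliceRestriction x).IsSymmetric := by
  intro e
  apply MvPolynomial.funext
  intro a
  rw [eval_rename, eval_sliceRestriction, eval_sliceRestriction]
  have swap := evalAt_sylvester_swap hx
  have cycle := evalAt_sylvester_cycle x
  have he := perm_fin_three e
  simp only [List.mem_cons, List.not_mem_nil, or_false, Prod.mk.injEq] at he
  simp only [Function.comp_apply]
  rcases he with ⟨h0, h1, h2⟩ | ⟨h0, h1, h2⟩ | ⟨h0, h1, h2⟩ | ⟨h0, h1, h2⟩ | ⟨h0, h1, h2⟩ |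
    ⟨h0, h1, h2⟩ <;> rw [h0, h1, h2]
  · rw [← cycle, swap]
  · rw [swap]
  · rw [← cycle]
  · rw [cycle]
  · rw [swap, cycle, cycle]

lemma exists_esymm_expansion {x : invariantRing 5} {m : ℕ}
    (hx : (x : MvPolynomial (Fin 6) ℂ).IsHomogeneous (4 * m)) :
    ∃ F : MvPolynomial (Fin 3) ℂ, ∀ u v w, evalAt (sylvester u v w) x =
      eval ![u + v + w, u * v + u * w + v * w, u * v * w] F := by
  obtain ⟨F, hF⟩ := esymmAlgHom_surjective (σ := Fin 3) (n := 3) ℂ (by simp)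
    ⟨sliceRestriction x, isSymmetric_sliceRestriction hx⟩
  refine ⟨F, fun u v w => ?_⟩
  have h := congrArg (fun s => eval ![u, v, w] s.val) hF
  simp only [esymmAlgHom_apply, eval_sliceRestriction] at h
  refine h.symm.trans ?_
  rw [eval_aeval]
  congr 2
  funext i
  have h2 : Finset.powersetCard 2 (Finset.univ : Finset (Fin 3)) = {{0, 1}, {0, 2}, {1, 2}} := by
    decide
  have h3 : Finset.powersetCard 3 (Finset.univ : Finset (Fin 3)) = {{0, 1, 2}} := by
    decide
  fin_cases i
  · simp [Fin.sum_univ_three]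
  · simp only [esymm, Fin.mk_one, Nat.reduceAdd, h2, map_sum, map_prod, eval_X]
    rw [Finset.sum_insert (by decide), Finset.sum_insert (by decide)]
    simp [add_assoc]
  · simp [esymm, h3, mul_assoc]

lemma mul_mem_adjoin_of_isHomogeneous {x : invariantRing 5} {m : ℕ}
    (hx : (x : MvPolynomial (Fin 6) ℂ).IsHomogeneous (4 * m)) :
    invariantGen12 ^ (5 * m) * x ∈
      Algebra.adjoin ℂ (Set.range ![invariantGen4, invariantGen8, invariantGen12]) := by
  obtain ⟨F, hF⟩ := exists_esymm_expansion hx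
  let D : invariantRing 5 := (1 / 3 : ℂ) • invariantGen12
  let y : Fin 3 → invariantRing 5 :=
    ![(1 / 4 : ℂ) • (invariantGen8 ^ 2 - D * invariantGen4), D ^ 2 * invariantGen8, D ^ 4]
  have key : D ^ (5 * m) * x = aeval y F := by
    refine eq_of_evalAt_sylvester fun u v w => ?_
    have hD : evalAt (sylvester u v w) D = (u * v * w) ^ 4 := by
      rw [map_smul, evalAt_invariantGen12, inv12_sylvester, smul_eq_mul]
      ring
    have hs : (u * v * w) ^ 5 • sylvester u v w =
        sylvester ((u * v * w) ^ 5 * u) ((u * v * w) ^ 5 * v) ((u * v * w) ^ 5 * w) := by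
      ext i
      fin_cases i <;> simp [sylvester] <;> ring
    have h := evalAt_smul hx ((u * v * w) ^ 5) (sylvester u v w)
    rw [hs, hF] at h
    rw [map_mul, map_pow, hD, ← AlgHom.comp_apply, comp_aeval, aeval_eq_eval]
    trans ((u * v * w) ^ 5) ^ (4 * m) * evalAt (sylvester u v w) x
    · ring
    rw [← h]
    congr 2
    funext i
    fin_cases i
    · simp [y, hD, evalAt_invariantGen4, evalAt_invariantGen8, inv4_sylvester, inv8_sylvester]
      ring
    · simp [y, hD, evalAt_invariantGen8, inv8_sylvester]
      ring
    · simp [y, hD]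
      ring
  have hgen : ∀ i, ![invariantGen4, invariantGen8, invariantGen12] i ∈
      Algebra.adjoin ℂ (Set.range ![invariantGen4, invariantGen8, invariantGen12]) :=
    fun i => Algebra.subset_adjoin ⟨i, rfl⟩
  have h4 := hgen 0
  have h8 := hgen 1
  have h12 := hgen 2
  simp only [Matrix.cons_val] at h4 h8 h12
  have hDm : D ∈ Algebra.adjoin ℂ (Set.range ![invariantGen4, invariantGen8, invariantGen12]) :=
    Subalgebra.smul_mem _ h12 _
  have hy : ∀ i, y i ∈
      Algebra.adjoin ℂ (Set.range ![invariantGen4, invariantGen8, invariantGen12]) := by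
    intro i
    fin_cases i
    · exact Subalgebra.smul_mem _ (sub_mem (pow_mem h8 2) (mul_mem hDm h4)) _
    · exact mul_mem (pow_mem hDm 2) h8
    · exact pow_mem hDm 4
  have hmem : aeval y F ∈
      Algebra.adjoin ℂ (Set.range ![invariantGen4, invariantGen8, invariantGen12]) := by
    have : aeval y F ∈ Algebra.adjoin ℂ (Set.range y) := by
      rw [Algebra.adjoin_range_eq_range_aeval]
      exact ⟨F, rfl⟩
    refine Algebra.adjoin_le ?_ this
    rintro _ ⟨i, rfl⟩
    exact hy i
  rw [← key] at hmem
  have h3 : invariantGen12 ^ (5 * m) * x = (3 : ℂ) ^ (5 * m) • (D ^ (5 * m) * x) := by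
    rw [smul_pow, smul_mul_assoc, smul_smul, ← mul_pow]
    norm_num
  rw [h3]
  exact Subalgebra.smul_mem _ hmem _

lemma mem_of_forall_isHomogeneous_mem (M : AddSubmonoid (invariantRing 5))
    (hM : ∀ (x : invariantRing 5) (n : ℕ), (x : MvPolynomial (Fin 6) ℂ).IsHomogeneous n → x ∈ M)
    (x : invariantRing 5) : x ∈ M := by
  have hx : x = ∑ d ∈ Finset.range ((x : MvPolynomial (Fin 6) ℂ).totalDegree + 1),
      ⟨homogeneousComponent d (x : MvPolynomial (Fin 6) ℂ),
        homogeneousComponent_mem_invariantRing x.2 d⟩ := by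
    apply Subtype.ext
    rw [AddSubmonoidClass.coe_finsetSum]
    exact (sum_homogeneousComponent _).symm
  rw [hx]
  exact sum_mem fun d _ => hM _ d (homogeneousComponent_isHomogeneous d _)

lemma eq_zero_of_isHomogeneous_odd {x : invariantRing 5} {n : ℕ} (hn : Odd n)
    (hx : (x : MvPolynomial (Fin 6) ℂ).IsHomogeneous n) : x = 0 := by
  refine eq_of_evalAt fun b => ?_
  have hdet : (-1 : ℂ) * (-1) - 0 * 0 = 1 := by simp
  have hb : quinticSubst (-1) 0 0 (-1) b = (-1 : ℂ) • b := by
    ext i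
    fin_cases i <;> simp [quinticSubst]
    all_goals ring
  have h := evalAt_quinticSubst hdet b x
  rw [hb, evalAt_smul hx, hn.neg_one_pow] at h
  rw [map_zero]
  linear_combination -h / 2

lemma mem_adjoin_range_iff {x : invariantRing 5} {y : Fin 3 → invariantRing 5} :
    x ∈ Algebra.adjoin ℂ (Set.range y) ↔ ∃ Q : MvPolynomial (Fin 3) ℂ, aeval y Q = x := by
  rw [Algebra.adjoin_range_eq_range_aeval]
  rfl

lemma evalAt_aeval (b : Fin 6 → ℂ) (y : Fin 3 → invariantRing 5) (Q : MvPolynomial (Fin 3) ℂ) :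
    evalAt b (aeval y Q) = eval (fun i => evalAt b (y i)) Q := by
  rw [← AlgHom.comp_apply, comp_aeval, aeval_eq_eval]

lemma evalAt_even_generators (b : Fin 6 → ℂ) :
    (fun i => evalAt b (![invariantGen4, invariantGen8, invariantGen12] i)) =
      ![inv4 b, inv8 b, inv12 b] := by
  funext i
  fin_cases i
  · exact evalAt_invariantGen4 b
  · exact evalAt_invariantGen8 b
  · exact evalAt_invariantGen12 b

lemma X_two_dvd {Q : MvPolynomial (Fin 3) ℂ} (hQ : ∀ x y, eval ![x, y, 0] Q = 0) : X 2 ∣ Q := by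
  have h0 : aeval ![X 0, X 1, (0 : MvPolynomial (Fin 3) ℂ)] Q = 0 := by
    apply MvPolynomial.funext
    intro a
    rw [eval_aeval, map_zero, ← hQ (a 0) (a 1)]
    congr 2
    funext i
    fin_cases i <;> simp
  rw [← Ideal.mem_span_singleton, ← Ideal.Quotient.eq_zero_iff_mem]
  let π := Ideal.Quotient.mkₐ ℂ (Ideal.span {(X 2 : MvPolynomial (Fin 3) ℂ)})
  have hπ : π.comp (aeval ![X 0, X 1, (0 : MvPolynomial (Fin 3) ℂ)]) = π := by
    ext i
    have h2 : π (X 2) = 0 :=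
      Ideal.Quotient.eq_zero_iff_mem.mpr (Ideal.mem_span_singleton_self _)
    fin_cases i <;> simp [h2]
  change π Q = 0
  rw [← hπ, AlgHom.comp_apply, h0, map_zero]

lemma mem_adjoin_of_invariantGen12_mul_mem {x : invariantRing 5}
    (hx : invariantGen12 * x ∈
      Algebra.adjoin ℂ (Set.range ![invariantGen4, invariantGen8, invariantGen12])) :
    x ∈ Algebra.adjoin ℂ (Set.range ![invariantGen4, invariantGen8, invariantGen12]) := by
  obtain ⟨Q, hQ⟩ := mem_adjoin_range_iff.mp hx
  obtain ⟨Q', rfl⟩ : X 2 ∣ Q := by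
    refine X_two_dvd fun u v => ?_
    obtain ⟨b, h4, h8, h12⟩ := exists_inv_eq u v 0
    have h := congrArg (evalAt b) hQ
    rwa [evalAt_aeval, evalAt_even_generators, map_mul, evalAt_invariantGen12, h4, h8, h12,
      zero_mul] at h
  refine mem_adjoin_range_iff.mpr ⟨Q', ?_⟩
  have h0 : invariantGen12 ≠ 0 := by
    intro h
    have := congrArg (evalAt (sylvester 1 1 1)) h
    rw [evalAt_invariantGen12, inv12_sylvester, map_zero] at this
    norm_num at this
  refine mul_left_cancel₀ h0 (Eq.trans ?_ hQ)
  rw [map_mul, aeval_X]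
  rfl

lemma mem_adjoin_of_isHomogeneous {x : invariantRing 5} {m : ℕ}
    (hx : (x : MvPolynomial (Fin 6) ℂ).IsHomogeneous (4 * m)) :
    x ∈ Algebra.adjoin ℂ (Set.range ![invariantGen4, invariantGen8, invariantGen12]) := by
  have h := mul_mem_adjoin_of_isHomogeneous hx
  generalize 5 * m = k at h
  induction k with
  | zero => rwa [pow_zero, one_mul] at h
  | succ k ih =>
    rw [pow_succ', mul_assoc] at h
    exact ih (mem_adjoin_of_invariantGen12_mul_mem h)

lemma isHomogeneous_invariantGen18_mul {x : invariantRing 5} {m : ℕ}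
    (hx : (x : MvPolynomial (Fin 6) ℂ).IsHomogeneous (4 * m + 2)) :
    ((invariantGen18 * x : invariantRing 5) : MvPolynomial (Fin 6) ℂ).IsHomogeneous
      (4 * (m + 5)) := by
  rw [show 4 * (m + 5) = 18 + (4 * m + 2) by ring]
  exact isHomogeneous_inv18.mul hx

lemma four_residue_cases (n : ℕ) : Odd n ∨ (∃ m, n = 4 * m) ∨ ∃ m, n = 4 * m + 2 := by
  rcases Nat.even_or_odd' n with ⟨k, rfl | rfl⟩
  · rcases Nat.even_or_odd' k with ⟨m, rfl | rfl⟩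
    · exact Or.inr (Or.inl ⟨m, by ring⟩)
    · exact Or.inr (Or.inr ⟨m, by ring⟩)
  · exact Or.inl ⟨k, rfl⟩

lemma invariantGen18_ne_zero : invariantGen18 ≠ 0 := by
  intro h
  have := congrArg (evalAt (sylvester 1 2 3)) h
  rw [evalAt_invariantGen18, inv18_sylvester, map_zero] at this
  norm_num at this

lemma finiteType_adjoin_range (y : Fin 3 → invariantRing 5) :
    Algebra.FiniteType ℂ (Algebra.adjoin ℂ (Set.range y)) :=
  Algebra.FiniteType.adjoin_of_finite (Set.finite_range y)

section FiniteExtension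

variable {A : Type*} [CommRing A] [Algebra ℂ A]

lemma Subalgebra.finite_of_closure_eq_top [IsDomain A] (B : Subalgebra ℂ A)
    [Algebra.FiniteType ℂ B] {t : A} (ht : t ≠ 0)
    (h : AddSubmonoid.closure {x | x ∈ B ∨ t * x ∈ B} = ⊤) : Module.Finite B A := by
  have hmemB : ∀ {x : A}, x ∈ B → x ∈ (1 : Submodule B A) :=
    fun {x} hx => Submodule.mem_one.mpr ⟨⟨x, hx⟩, rfl⟩
  have hnoeth : IsNoetherianRing B := Algebra.FiniteType.isNoetherianRing ℂ B
  have hone : (1 : Submodule B A).FG := by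
    rw [Submodule.one_eq_span]
    exact Submodule.fg_span_singleton _
  let f : A →ₗ[B] A := LinearMap.mulLeft B t
  have hcomap : (Submodule.comap f 1).FG :=
    Submodule.fg_of_fg_map_injective f (mul_right_injective₀ ht)
      (hone.of_le (Submodule.map_comap_le f 1))
  have htop : (1 : Submodule B A) ⊔ Submodule.comap f 1 = ⊤ := by
    refine eq_top_iff.mpr fun x _ => ?_
    have hle : AddSubmonoid.closure {x | x ∈ B ∨ t * x ∈ B} ≤
        ((1 : Submodule B A) ⊔ Submodule.comap f 1).toAddSubmonoid := by
      refine AddSubmonoid.closure_le.mpr ?_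
      rintro y (hy | hy)
      · exact Submodule.mem_sup_left (hmemB hy)
      · exact Submodule.mem_sup_right (hmemB hy)
    exact hle (h ▸ AddSubmonoid.mem_top x)
  exact ⟨htop ▸ hone.sup hcomap⟩

lemma isIntegral_of_syzygy (D : Subalgebra ℂ A) {a b c t : A} (ha : a ∈ D) (hb : b ∈ D)
    (hc : c ∈ D) (h : 16 * c ^ 2 = a * (3 * b ^ 2 - t * a) ^ 2 + 24 * b ^ 3 * t -
      72 * b * a * t ^ 2 - 144 * t ^ 3) : IsIntegral D t := by
  lift a to D using ha
  lift b to D using hb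
  lift c to D using hc
  let k : D := algebraMap ℂ D (1 / 144)
  have hk : algebraMap D A k * 144 = 1 := by
    rw [← IsScalarTower.algebraMap_apply, ← map_ofNat (algebraMap ℂ A) 144, ← map_mul]
    norm_num
  refine ⟨Polynomial.X ^ 3 + (Polynomial.C (k * (72 * b * a - a ^ 3)) * Polynomial.X ^ 2 +
    Polynomial.C (k * (6 * b ^ 2 * a ^ 2 - 24 * b ^ 3)) * Polynomial.X +
    Polynomial.C (k * (16 * c ^ 2 - 9 * a * b ^ 4))), ?_, ?_⟩
  · refine Polynomial.monic_X_pow_add ?_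
    exact Polynomial.degree_quadratic_lt
  · simp only [Polynomial.eval₂_add, Polynomial.eval₂_mul, Polynomial.eval₂_pow,
      Polynomial.eval₂_X, Polynomial.eval₂_C]
    simp only [map_mul, map_sub, map_pow, map_ofNat]
    have ha : algebraMap D A a = a := rfl
    have hb : algebraMap D A b = b := rfl
    have hc : algebraMap D A c = c := rfl
    rw [ha, hb, hc]
    linear_combination algebraMap D A k * h - t ^ 3 * hk

lemma isIntegral_of_mem_adjoin (D : Subalgebra ℂ A) {s : Set A} (hs : ∀ y ∈ s, IsIntegral D y)
    {x : A} (hx : x ∈ Algebra.adjoin ℂ s) : IsIntegral D x :=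
  Algebra.adjoin_le (S := (integralClosure D A).restrictScalars ℂ) hs hx

lemma finite_of_finite_adjoin (D : Subalgebra ℂ A) {s : Set A} (hfin : s.Finite)
    (hs : ∀ y ∈ s, IsIntegral D y) [Module.Finite (Algebra.adjoin ℂ s) A] :
    Module.Finite D A := by
  have hft : Algebra.FiniteType ℂ A :=
    Algebra.FiniteType.trans (Algebra.FiniteType.adjoin_of_finite hfin)
      (inferInstanceAs (Algebra.FiniteType (Algebra.adjoin ℂ s) A))
  have : Algebra.FiniteType D A := Algebra.FiniteType.of_restrictScalars_finiteType ℂ D A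
  let φ : Algebra.adjoin ℂ s →+* integralClosure D A :=
    (algebraMap (Algebra.adjoin ℂ s) A).codRestrict (integralClosure D A)
      fun y => isIntegral_of_mem_adjoin D hs y.2
  have : Algebra.IsIntegral D A := ⟨fun x => isIntegral_trans (A := integralClosure D A) x
    ((Algebra.IsIntegral.isIntegral (R := Algebra.adjoin ℂ s) x).map_of_comp_eq φ (RingHom.id A)
      rfl)⟩
  exact Algebra.IsIntegral.finite

lemma finite_adjoin_of_syzygy {a b c t : A}
    [Module.Finite (Algebra.adjoin ℂ (Set.range ![a, b, t])) A]
    (h : 16 * c ^ 2 = a * (3 * b ^ 2 - t * a) ^ 2 + 24 * b ^ 3 * t -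
      72 * b * a * t ^ 2 - 144 * t ^ 3) :
    Module.Finite (Algebra.adjoin ℂ (Set.range ![a, b, c])) A := by
  have hg : ∀ i, ![a, b, c] i ∈ Algebra.adjoin ℂ (Set.range ![a, b, c]) := fun i =>
    Algebra.subset_adjoin ⟨i, rfl⟩
  have hint : ∀ {y : A}, y ∈ Algebra.adjoin ℂ (Set.range ![a, b, c]) →
      IsIntegral (Algebra.adjoin ℂ (Set.range ![a, b, c])) y := fun {y} hy =>
    isIntegral_algebraMap (x := (⟨y, hy⟩ : Algebra.adjoin ℂ (Set.range ![a, b, c])))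
  refine finite_of_finite_adjoin _ (Set.finite_range ![a, b, t]) ?_
  rintro _ ⟨i, rfl⟩
  fin_cases i
  · exact hint (hg 0)
  · exact hint (hg 1)
  · exact isIntegral_of_syzygy _ (hg 0) (hg 1) (hg 2) h

end FiniteExtension

lemma closure_mem_or_invariantGen18_mul_mem :
    AddSubmonoid.closure
      {x | x ∈ Algebra.adjoin ℂ (Set.range ![invariantGen4, invariantGen8, invariantGen12]) ∨
        invariantGen18 * x ∈
          Algebra.adjoin ℂ (Set.range ![invariantGen4, invariantGen8, invariantGen12])} = ⊤ := by
  refine eq_top_iff.mpr fun x _ => mem_of_forall_isHomogeneous_mem _ (fun x n hx => ?_) x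
  rcases four_residue_cases n with hn | ⟨m, rfl⟩ | ⟨m, rfl⟩
  · rw [eq_zero_of_isHomogeneous_odd hn hx]
    exact zero_mem _
  · exact AddSubmonoid.subset_closure (Or.inl (mem_adjoin_of_isHomogeneous hx))
  · exact AddSubmonoid.subset_closure
      (Or.inr (mem_adjoin_of_isHomogeneous (isHomogeneous_invariantGen18_mul hx)))

lemma finite_adjoin_four_eight_twelve :
    Module.Finite (Algebra.adjoin ℂ (Set.range ![invariantGen4, invariantGen8, invariantGen12]))
      (invariantRing 5) :=
  have := finiteType_adjoin_range ![invariantGen4, invariantGen8, invariantGen12]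
  Subalgebra.finite_of_closure_eq_top _ invariantGen18_ne_zero closure_mem_or_invariantGen18_mul_mem

lemma finite_adjoin_four_eight_eighteen :
    Module.Finite (Algebra.adjoin ℂ (Set.range ![invariantGen4, invariantGen8, invariantGen18]))
      (invariantRing 5) :=
  have := finite_adjoin_four_eight_twelve
  finite_adjoin_of_syzygy inv_syzygy

lemma algebraicIndependent_of_evalAt_surjective {y : Fin 3 → invariantRing 5}
    (hy : ∀ a : Fin 3 → ℂ, ∃ b, (fun i => evalAt b (y i)) = a) : AlgebraicIndependent ℂ y := by
  rw [algebraicIndependent_iff]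
  intro Q hQ
  apply MvPolynomial.funext
  intro a
  obtain ⟨b, rfl⟩ := hy a
  rw [← evalAt_aeval, hQ, map_zero, map_zero]

lemma algebraicIndependent_four_eight_twelve :
    AlgebraicIndependent ℂ ![invariantGen4, invariantGen8, invariantGen12] := by
  refine algebraicIndependent_of_evalAt_surjective fun a => ?_
  obtain ⟨b, h4, h8, h12⟩ := exists_inv_eq (a 0) (a 1) (a 2)
  refine ⟨b, ?_⟩
  rw [evalAt_even_generators, h4, h8, h12]
  funext i
  fin_cases i <;> rfl

lemma inv_syzygy_eval (b : Fin 6 → ℂ) :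
    16 * inv18 b ^ 2 = inv4 b * (3 * inv8 b ^ 2 - inv12 b * inv4 b) ^ 2 +
      24 * inv8 b ^ 3 * inv12 b - 72 * inv8 b * inv4 b * inv12 b ^ 2 - 144 * inv12 b ^ 3 := by
  have h := congrArg (evalAt b) inv_syzygy
  simpa only [map_mul, map_add, map_sub, map_pow, map_ofNat, evalAt_invariantGen4,
    evalAt_invariantGen8, evalAt_invariantGen12, evalAt_invariantGen18] using h

lemma exists_inv_eq_odd (x y w : ℂ) :
    ∃ b : Fin 6 → ℂ, inv4 b = x ∧ inv8 b = y ∧ inv18 b = w := by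
  obtain ⟨z, hz⟩ := exists_root_cubic (show (-144 : ℂ) ≠ 0 by norm_num) (x ^ 3 - 72 * y * x)
    (24 * y ^ 3 - 6 * x ^ 2 * y ^ 2) (9 * x * y ^ 4 - 16 * w ^ 2)
  obtain ⟨b, rfl, rfl, rfl⟩ := exists_inv_eq x y z
  have hw : inv18 b ^ 2 = w ^ 2 := by
    linear_combination (inv_syzygy_eval b + hz) / 16
  rcases sq_eq_sq_iff_eq_or_eq_neg.mp hw with h | h
  · exact ⟨b, rfl, rfl, h⟩
  · refine ⟨Complex.I • b, ?_, ?_, ?_⟩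
    · rw [inv4_smul, Complex.I_pow_four, one_mul]
    · rw [inv8_smul, show Complex.I ^ 8 = (Complex.I ^ 4) ^ 2 by ring, Complex.I_pow_four]
      ring
    · rw [inv18_smul, show Complex.I ^ 18 = (Complex.I ^ 4) ^ 4 * Complex.I ^ 2 by ring,
        Complex.I_pow_four, Complex.I_sq, h]
      ring

lemma algebraicIndependent_four_eight_eighteen :
    AlgebraicIndependent ℂ ![invariantGen4, invariantGen8, invariantGen18] := by
  refine algebraicIndependent_of_evalAt_surjective fun a => ?_
  obtain ⟨b, h4, h8, h18⟩ := exists_inv_eq_odd (a 0) (a 1) (a 2)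
  refine ⟨b, ?_⟩
  funext i
  fin_cases i
  · exact (evalAt_invariantGen4 b).trans h4
  · exact (evalAt_invariantGen8 b).trans h8
  · exact (evalAt_invariantGen18 b).trans h18

theorem stmt_13 :
    (∃ p : Fin (5-2) → invariantRing 5, IsHSOP 5 ![4, 8, 12] p) ∧
    (∃ p : Fin (5-2) → invariantRing 5, IsHSOP 5 ![4, 8, 18] p) := by
  refine ⟨⟨![invariantGen4, invariantGen8, invariantGen12], ?_, ?_,
    algebraicIndependent_four_eight_twelve, finite_adjoin_four_eight_twelve⟩,
    ⟨![invariantGen4, invariantGen8, invariantGen18], ?_, ?_,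
    algebraicIndependent_four_eight_eighteen, finite_adjoin_four_eight_eighteen⟩⟩
  · intro k
    fin_cases k <;> simp
  · intro k
    fin_cases k
    · exact isHomogeneous_inv4
    · exact isHomogeneous_inv8
    · exact isHomogeneous_inv12
  · intro k
    fin_cases k <;> simp
  · intro k
    fin_cases k
    · exact isHomogeneous_inv4
    · exact isHomogeneous_inv8
    · exact isHomogeneous_inv18
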